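/- The spectral norm of the softmax-attention covariance matrix is at most c. Precisely, let M = Σ_{j=1}^N P_{ij} (y_j − ȳ)(y_j − ȳ)⊤ ∈ ℝ^{d×d} be the covariance matrix of the discrete distribution on {y_1,…,y_N} with probabilities P_{i1},…,P_{iN}. Then ‖M‖₂ ≤ c, where ‖·‖₂ denotes the operator norm induced by the Euclidean vector norm (equal to the largest eigenvalue of the symmetric positive semidefinite matrix M). -/

import Mathlib

/-- The norm of a sum of weighted rank-one matrices applied to a unit vector is at most the trace. -/
theorem sqrt_sum_sq_mulVec_le_of_eq_sum {ι n : Type*} [Fintype ι] [Fintype n]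
    (p : ι → ℝ) (hp : ∀ j, 0 ≤ p j) (v : ι → n → ℝ) (M : Matrix n n ℝ)
    (hM : ∀ l m, M l m = ∑ j, p j * v j l * v j m)
    (x : n → ℝ) (hx : Real.sqrt (∑ j, x j ^ 2) = 1) :
    Real.sqrt (∑ l, M.mulVec x l ^ 2) ≤ ∑ j, p j * ∑ m, v j m ^ 2 := by
  have norm_eq (u : n → ℝ) : ‖WithLp.toLp 2 u‖ = Real.sqrt (∑ l, u l ^ 2) := by
    simp [EuclideanSpace.norm_eq]
  have inner_eq (u w : n → ℝ) :
      inner ℝ (WithLp.toLp 2 u) (WithLp.toLp 2 w) = ∑ l, u l * w l := by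
    simp [PiLp.inner_apply, mul_comm]
  have hsum : WithLp.toLp 2 (M.mulVec x) =
      ∑ j, (p j * inner ℝ (WithLp.toLp 2 (v j)) (WithLp.toLp 2 x)) • WithLp.toLp 2 (v j) := by
    ext l
    simp only [inner_eq, WithLp.ofLp_sum, WithLp.ofLp_smul, Finset.sum_apply, Pi.smul_apply,
      smul_eq_mul, Matrix.mulVec, dotProduct, hM, Finset.sum_mul, Finset.mul_sum]
    rw [Finset.sum_comm]
    exact Finset.sum_congr rfl fun j _ => Finset.sum_congr rfl fun m _ => by ring
  rw [← norm_eq] at hx ⊢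
  rw [hsum]
  refine (norm_sum_le _ _).trans (Finset.sum_le_sum fun j _ => ?_)
  have hcs := abs_real_inner_le_norm (WithLp.toLp 2 (v j)) (WithLp.toLp 2 x)
  rw [hx, mul_one] at hcs
  have hsq : ‖WithLp.toLp 2 (v j)‖ ^ 2 = ∑ m, v j m ^ 2 := by
    rw [norm_eq, Real.sq_sqrt (Finset.sum_nonneg fun m _ => sq_nonneg _)]
  rw [norm_smul, Real.norm_eq_abs, abs_mul, abs_of_nonneg (hp j), ← hsq, sq, mul_assoc]
  gcongr
  exact hp j

/-- The weighted mean minimizes the weighted mean square deviation. -/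
theorem sum_mul_sub_mean_sq_le {ι : Type*} [Fintype ι] (p z : ι → ℝ) (hp : ∑ j, p j = 1)
    (μ a : ℝ) (hμ : μ = ∑ j, p j * z j) :
    ∑ j, p j * (z j - μ) ^ 2 ≤ ∑ j, p j * (z j - a) ^ 2 := by
  have key : ∑ j, p j * (z j - a) ^ 2 - ∑ j, p j * (z j - μ) ^ 2 = (μ - a) ^ 2 := by
    calc _ = 2 * (μ - a) * ∑ j, p j * z j - (μ ^ 2 - a ^ 2) * ∑ j, p j := by
          rw [← Finset.sum_sub_distrib, Finset.mul_sum, Finset.mul_sum, ← Finset.sum_sub_distrib]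
          exact Finset.sum_congr rfl fun j _ => by ring
      _ = _ := by rw [hp, ← hμ]; ring
  linarith [sq_nonneg (μ - a)]

theorem sub_mul_exp_neg_le (s c : ℝ) : (s - c) * Real.exp (-s) ≤ Real.exp (-(c + 1)) := by
  have h := mul_le_mul_of_nonneg_right (Real.add_one_le_exp (s - c - 1)) (Real.exp_pos (-s)).le
  rwa [← Real.exp_add, sub_add_cancel, show s - c - 1 + -s = -(c + 1) by ring] at h

/-- If one of the energies `s j` vanishes, their Gibbs average is at most the solution `c` of
`c * exp (c + 1) = card ι - 1`. -/
theorem sum_exp_neg_mul_le {ι : Type*} [Fintype ι] (s : ι → ℝ) (i : ι) (hi : s i = 0)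
    (c : ℝ) (hc : c * Real.exp (c + 1) = (Fintype.card ι : ℝ) - 1) :
    ∑ j, Real.exp (-s j) * s j ≤ c * ∑ j, Real.exp (-s j) := by
  classical
  have hrest : ∑ j ∈ Finset.univ.erase i, (s j - c) * Real.exp (-s j) ≤ c := by
    calc _ ≤ ∑ j ∈ Finset.univ.erase i, Real.exp (-(c + 1)) :=
          Finset.sum_le_sum fun j _ => sub_mul_exp_neg_le _ _
      _ = ((Fintype.card ι : ℝ) - 1) * Real.exp (-(c + 1)) := by
          rw [Finset.sum_const, nsmul_eq_mul, Finset.cast_card_erase_of_mem (Finset.mem_univ i),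
            Finset.card_univ]
      _ = c := by rw [← hc, mul_assoc, ← Real.exp_add, add_neg_cancel, Real.exp_zero, mul_one]
  have hall : ∑ j, (s j - c) * Real.exp (-s j) =
      ∑ j, Real.exp (-s j) * s j - c * ∑ j, Real.exp (-s j) := by
    rw [Finset.mul_sum, ← Finset.sum_sub_distrib]
    exact Finset.sum_congr rfl fun j _ => by ring
  rw [← Finset.add_sum_erase _ _ (Finset.mem_univ i), hi] at hall
  simp only [neg_zero, Real.exp_zero] at hall
  linarith


open Matrix BigOperators

/-- Spectral norm (operator norm induced by the Euclidean vector norm):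
`sup_{‖x‖₂ = 1} ‖M x‖₂`. -/
noncomputable def specNorm {m n : Type*} [Fintype m] [Fintype n]
    (M : Matrix m n ℝ) : ℝ :=
  sSup {r : ℝ | ∃ x : n → ℝ, Real.sqrt (∑ j, x j ^ 2) = 1 ∧
    r = Real.sqrt (∑ i, M.mulVec x i ^ 2)}

/-- The spectral norm of the softmax-attention covariance matrix
`M = ∑ⱼ Pⱼ (yⱼ − ȳ)(yⱼ − ȳ)ᵀ` is at most `c`, where `Pⱼ` are the softmax
weights `Pⱼ ∝ exp(−‖yⱼ − yᵢ‖₂²)`, `ȳ = ∑ₖ Pₖ yₖ`, and `c·exp(c+1) = N − 1`. -/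
theorem softmax_cov_specNorm_le
    (N d : ℕ) (hN : 1 ≤ N) (hd : 1 ≤ d)
    (y : Fin N → Fin d → ℝ) (i : Fin N)
    (P : Fin N → ℝ)
    (hP : ∀ j, P j = Real.exp (-(∑ m, (y j m - y i m) ^ 2)) /
      ∑ k, Real.exp (-(∑ m, (y k m - y i m) ^ 2)))
    (ybar : Fin d → ℝ) (hybar : ∀ m, ybar m = ∑ k, P k * y k m)
    (M : Matrix (Fin d) (Fin d) ℝ)
    (hM : ∀ l m, M l m = ∑ j, P j * (y j l - ybar l) * (y j m - ybar m))
    (c : ℝ) (hc0 : 0 ≤ c) (hc : c * Real.exp (c + 1) = (N : ℝ) - 1) :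
    specNorm M ≤ c := by
  have hZ : 0 < ∑ k, Real.exp (-(∑ m, (y k m - y i m) ^ 2)) :=
    Finset.sum_pos (fun _ _ => Real.exp_pos _) ⟨i, Finset.mem_univ i⟩
  have hP0 (j : Fin N) : 0 ≤ P j := by rw [hP]; positivity
  have hP1 : ∑ j, P j = 1 := by
    simp only [hP]
    rw [← Finset.sum_div, div_self hZ.ne']
  have htrace : ∑ j, P j * ∑ m, (y j m - ybar m) ^ 2 ≤ ∑ j, P j * ∑ m, (y j m - y i m) ^ 2 := by
    simp only [Finset.mul_sum]
    rw [Finset.sum_comm, Finset.sum_comm (f := fun j m => P j * (y j m - y i m) ^ 2)]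
    exact Finset.sum_le_sum fun m _ =>
      sum_mul_sub_mean_sq_le P (fun j => y j m) hP1 _ _ (hybar m)
  have hgibbs : ∑ j, P j * ∑ m, (y j m - y i m) ^ 2 ≤ c := by
    simp only [hP, div_mul_eq_mul_div]
    rw [← Finset.sum_div, div_le_iff₀ hZ]
    exact sum_exp_neg_mul_le (fun j => ∑ m, (y j m - y i m) ^ 2) i (by simp) c (by simpa using hc)
  refine Real.sSup_le ?_ hc0
  rintro r ⟨x, hx, rfl⟩
  exact (sqrt_sum_sq_mulVec_le_of_eq_sum P hP0 (fun j m => y j m - ybar m) M hM x hx).trans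
    (htrace.trans hgibbs)
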